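/- Let k ≥ 3 be an integer. For every N ∈ ℕ there exists a constant C, depending only on k and N, such that for every smooth function G : ℝ → ℂ with support contained in [1/4, 5/4], every real X ≥ 1, all positive integers l, f, and every nonzero ξ ∈ ℤ: | J_{l,f}(ξ, 0, X) | ≤ C · ‖G‖_1 · X^{(N+3)/2} / ( (lf²)^N · |ξ|^{N+2} ), where ‖G‖_1 = ∫_ℝ |G(t)| dt. -/

import Mathlib

open MeasureTheory

/-- `e(t) = e^{2πit}`. -/
noncomputable def e2 (t : ℝ) : ℂ := Complex.exp (2 * Real.pi * Complex.I * t)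

/-- The archimedean test function `θ_∞` attached to weight `k`:
`θ_∞(x) = (i/(2π))·((x + i√(1−x²))^{k−1} − (x − i√(1−x²))^{k−1})` for `|x| < 1`,
and `0` otherwise. -/
noncomputable def thetaInf (k : ℕ) (x : ℝ) : ℂ :=
  if |x| < 1 then
    (Complex.I / (2 * (Real.pi : ℂ))) *
      (((x : ℂ) + Complex.I * (Real.sqrt (1 - x ^ 2) : ℝ)) ^ (k - 1) -
        ((x : ℂ) - Complex.I * (Real.sqrt (1 - x ^ 2) : ℝ)) ^ (k - 1))
  else 0

/-- The cutoff `F(x) = (∫_x^∞ e^{−y−1/y} y^{−1} dy)/(∫_0^∞ e^{−y−1/y} y^{−1} dy)`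
from the approximate functional equation. -/
noncomputable def Fcut (x : ℝ) : ℝ :=
  (∫ y in Set.Ioi x, Real.exp (-y - 1/y) / y) /
    (∫ y in Set.Ioi (0 : ℝ), Real.exp (-y - 1/y) / y)

/-- The Mellin transform `F̃(u) = ∫_0^∞ F(x)·x^{u−1} dx`. -/
noncomputable def Ftilde (u : ℂ) : ℂ :=
  ∫ x in Set.Ioi (0 : ℝ), (Fcut x : ℂ) * (x : ℂ) ^ (u - 1)

/-- `H(y) = (√π/(2π)) ∫_{Re u = 1} (Γ((1+u)/2)/Γ((2−u)/2))·(πy)^{−u}·F̃(u) du`,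
written as an integral over `t ∈ ℝ` with `u = 1 + it`. -/
noncomputable def Hfun (y : ℝ) : ℂ :=
  ((Real.sqrt Real.pi / (2 * Real.pi) : ℝ) : ℂ) *
    ∫ t : ℝ,
      (Complex.Gamma ((2 + (t : ℂ) * Complex.I) / 2) /
          Complex.Gamma ((1 - (t : ℂ) * Complex.I) / 2)) *
        ((Real.pi * y : ℝ) : ℂ) ^ (-(1 + (t : ℂ) * Complex.I)) *
        Ftilde (1 + (t : ℂ) * Complex.I)

/-- The Fourier transform
`J_{l,f}(ξ, ν, X) = ∫_0^∞ ∫_{−1}^{1} √y·G(y/X)·θ_∞(x)·{F(lf²/(2√y√(1−x²))) +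
(lf²/(2√y√(1−x²)))·H(lf²/(2√y√(1−x²)))}·e(−(2xξ√y + yν)/(4lf²)) dx dy`. -/
noncomputable def Jlf (k l f : ℕ) (ξ ν : ℤ) (X : ℝ) (G : ℝ → ℂ) : ℂ :=
  ∫ y in Set.Ioi (0 : ℝ), ∫ x in (-1 : ℝ)..1,
    ((Real.sqrt y : ℝ) : ℂ) * G (y / X) * thetaInf k x *
      (((Fcut ((l * f ^ 2 : ℝ) / (2 * Real.sqrt y * Real.sqrt (1 - x ^ 2))) : ℝ) : ℂ) +
        (((l * f ^ 2 : ℝ) / (2 * Real.sqrt y * Real.sqrt (1 - x ^ 2)) : ℝ) : ℂ) *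
          Hfun ((l * f ^ 2 : ℝ) / (2 * Real.sqrt y * Real.sqrt (1 - x ^ 2)))) *
      e2 (-(2 * x * (ξ : ℝ) * Real.sqrt y + y * (ν : ℝ)) / (4 * (l : ℝ) * (f : ℝ) ^ 2))


noncomputable def ph (y : ℝ) : ℝ := Real.exp (-y - 1/y)

lemma ph_pos (y : ℝ) : 0 < ph y := Real.exp_pos _

lemma pow_mul_exp_neg_le (n : ℕ) (z : ℝ) (hz : 0 ≤ z) : z ^ n * Real.exp (-z) ≤ n.factorial := by
  have h := Real.pow_div_factorial_le_exp z hz n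
  rw [div_le_iff₀ (by positivity)] at h
  rw [Real.exp_neg, ← div_eq_mul_inv, div_le_iff₀ (Real.exp_pos _)]
  linarith

lemma ph_eq (z : ℝ) : ph z = Real.exp (-z) * Real.exp (-(1/z)) := by
  unfold ph; rw [← Real.exp_add]; ring_nf

lemma ph_bound (m : ℤ) : ∃ C : ℝ, 0 ≤ C ∧ ∀ z : ℝ, 0 < z → z ^ m * ph z ≤ C := by
  obtain ⟨n, rfl | rfl⟩ := m.eq_nat_or_neg
  · refine ⟨n.factorial, by positivity, fun z hz => ?_⟩
    have h1 := pow_mul_exp_neg_le n z hz.le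
    have h2 : Real.exp (-(1/z)) ≤ 1 := by
      rw [Real.exp_le_one_iff]; have : 0 < 1/z := by positivity
      linarith
    rw [ph_eq, zpow_natCast, ← mul_assoc]
    calc _ ≤ z ^ n * Real.exp (-z) * 1 := by gcongr
      _ ≤ _ := by linarith
  · refine ⟨n.factorial, by positivity, fun z hz => ?_⟩
    have h1 := pow_mul_exp_neg_le n (1/z) (by positivity)
    have h2 : Real.exp (-z) ≤ 1 := by
      rw [Real.exp_le_one_iff]; linarith
    have : z ^ (-(n:ℤ)) = (1/z)^n := by simp
    rw [ph_eq, this]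
    calc _ = (1/z) ^ n * Real.exp (-(1/z)) * Real.exp (-z) := by ring
      _ ≤ (1/z) ^ n * Real.exp (-(1/z)) * 1 := by gcongr
      _ ≤ _ := by linarith

lemma ph_hasDerivAt (z : ℝ) (hz : 0 < z) : HasDerivAt ph ((-1 + 1/z^2) * ph z) z := by
  have h : HasDerivAt (fun y : ℝ => -y - 1/y) (-1 + 1/z^2) z := by
    have h1 := (hasDerivAt_inv hz.ne').const_mul (1:ℝ)
    have h2 := (hasDerivAt_id z).neg.sub h1
    have e1 : (fun y : ℝ => -y - 1/y) = -id - fun y => 1 * y⁻¹ := by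
      funext y; simp
    have e2 : -1 + 1/z^2 = -1 - 1 * -(z ^ 2)⁻¹ := by rw [one_div]; ring
    rw [e1, e2]
    exact h2
  have := h.exp
  unfold ph
  convert this using 1
  ring

lemma ph_continuousOn : ContinuousOn ph (Set.Ioi 0) := fun z hz =>
  (ph_hasDerivAt z hz).continuousAt.continuousWithinAt

lemma phC_continuousOn : ContinuousOn (fun y => (ph y : ℂ)) (Set.Ioi 0) :=
  Complex.continuous_ofReal.comp_continuousOn ph_continuousOn

lemma ph_le_rpow (m : ℤ) : ∃ C : ℝ, 0 ≤ C ∧ ∀ z : ℝ, 0 < z → ‖(ph z : ℂ)‖ ≤ C * z ^ (-(m:ℝ)) := by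
  obtain ⟨C, hC, h⟩ := ph_bound m
  refine ⟨C, hC, fun z hz => ?_⟩
  have := h z hz
  rw [Complex.norm_real, Real.norm_of_nonneg (ph_pos z).le, Real.rpow_neg hz.le, Real.rpow_intCast,
    ← div_eq_mul_inv, le_div_iff₀ (by positivity)]
  linarith

noncomputable def EE (u : ℂ) : ℂ := mellin (fun y => (ph y : ℂ)) u

lemma ph_bigO_top (m : ℤ) : (fun y => (ph y : ℂ)) =O[Filter.atTop] fun x => x ^ (-(m:ℝ)) := by
  obtain ⟨C, hC, h⟩ := ph_le_rpow m
  refine Asymptotics.IsBigO.of_bound C ?_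
  filter_upwards [Filter.eventually_gt_atTop 0] with z hz
  rw [Real.norm_of_nonneg (by positivity)]; exact h z hz

lemma ph_bigO_zero (m : ℤ) : (fun y => (ph y : ℂ)) =O[nhdsWithin 0 (Set.Ioi 0)] fun x => x ^ (-(m:ℝ)) := by
  obtain ⟨C, hC, h⟩ := ph_le_rpow m
  refine Asymptotics.IsBigO.of_bound C ?_
  filter_upwards [self_mem_nhdsWithin] with z hz
  rw [Real.norm_of_nonneg (Real.rpow_nonneg (le_of_lt hz) _)]; exact h z hz

lemma ph_locInt : LocallyIntegrableOn (fun y => (ph y : ℂ)) (Set.Ioi 0) :=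
  phC_continuousOn.locallyIntegrableOn measurableSet_Ioi

lemma EE_conv (u : ℂ) : MellinConvergent (fun y => (ph y : ℂ)) u := by
  refine mellinConvergent_of_isBigO_rpow (a := ((⌈u.re⌉+1:ℤ):ℝ)) (b := ((⌊u.re⌋-1:ℤ):ℝ)) ph_locInt (ph_bigO_top _) ?_ (ph_bigO_zero _) ?_
  · push_cast; linarith [Int.le_ceil u.re]
  · push_cast; linarith [Int.floor_le u.re]

lemma EE_diff (u : ℂ) : DifferentiableAt ℂ EE u := by
  refine mellin_differentiableAt_of_isBigO_rpow (a := ((⌈u.re⌉+1:ℤ):ℝ)) (b := ((⌊u.re⌋-1:ℤ):ℝ)) ph_locInt (ph_bigO_top _) ?_ (ph_bigO_zero _) ?_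
  · push_cast; linarith [Int.le_ceil u.re]
  · push_cast; linarith [Int.floor_le u.re]

lemma phr_integrable (a : ℝ) : IntegrableOn (fun y : ℝ => y ^ (a-1) * ph y) (Set.Ioi 0) := by
  have h := (EE_conv (a:ℂ)).norm
  refine IntegrableOn.congr_fun h (fun y hy => ?_) measurableSet_Ioi
  simp only [norm_smul]
  rw [Complex.norm_cpow_eq_rpow_re_of_pos hy, Complex.norm_real, Real.norm_of_nonneg (ph_pos y).le]
  simp

lemma rpow_le_add (a b s y : ℝ) (hy : 0 < y) (h1 : a ≤ s) (h2 : s ≤ b) : y ^ s ≤ y ^ a + y ^ b := by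
  rcases le_total 1 y with h | h
  · have := Real.rpow_le_rpow_of_exponent_le h h2
    have := Real.rpow_pos_of_pos hy a
    linarith
  · have := Real.rpow_le_rpow_of_exponent_ge hy h h1
    have := Real.rpow_pos_of_pos hy b
    linarith

lemma EE_bdd (a b : ℝ) : ∃ C : ℝ, 0 ≤ C ∧ ∀ u : ℂ, a ≤ u.re → u.re ≤ b → ‖EE u‖ ≤ C := by
  refine ⟨∫ y in Set.Ioi (0:ℝ), (y ^ (a-1) * ph y + y ^ (b-1) * ph y), ?_, fun u h1 h2 => ?_⟩
  · refine setIntegral_nonneg measurableSet_Ioi fun y hy => ?_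
    have := ph_pos y
    have hy' : 0 < y := hy
    positivity
  · refine norm_integral_le_of_norm_le ((phr_integrable a).add (phr_integrable b)) ?_
    filter_upwards [ae_restrict_mem measurableSet_Ioi] with y hy
    rw [norm_smul, Complex.norm_cpow_eq_rpow_re_of_pos hy, Complex.norm_real, Real.norm_of_nonneg (ph_pos y).le, ← add_mul]
    gcongr
    · exact (ph_pos y).le
    · exact rpow_le_add _ _ _ _ hy (by simpa using h1) (by simpa using h2)

lemma zpow_ph_tendsto_zero (u : ℂ) :
    Filter.Tendsto (fun y : ℝ => (ph y : ℂ) * (y : ℂ) ^ u) (nhdsWithin 0 (Set.Ioi 0)) (nhds 0) := by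
  obtain ⟨C, hC, h⟩ := ph_le_rpow (⌊u.re⌋-1)
  have ht : Filter.Tendsto (fun y : ℝ => C * y ^ (u.re - ((⌊u.re⌋-1:ℤ):ℝ))) (nhdsWithin 0 (Set.Ioi 0)) (nhds 0) := by
    have hp : 0 < u.re - ((⌊u.re⌋-1:ℤ):ℝ) := by push_cast; linarith [Int.floor_le u.re]
    have := (Real.continuousAt_rpow_const 0 _ (Or.inr hp.le)).tendsto.const_mul C
    rw [Real.zero_rpow hp.ne', mul_zero] at this
    exact this.mono_left nhdsWithin_le_nhds
  refine squeeze_zero_norm' ?_ ht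
  filter_upwards [self_mem_nhdsWithin] with y hy
  have hy' : 0 < y := hy
  rw [norm_mul, Complex.norm_cpow_eq_rpow_re_of_pos hy, sub_eq_add_neg, add_comm, Real.rpow_add hy, ← mul_assoc]
  gcongr
  exact h y hy

lemma zpow_ph_tendsto_top (u : ℂ) :
    Filter.Tendsto (fun y : ℝ => (ph y : ℂ) * (y : ℂ) ^ u) Filter.atTop (nhds 0) := by
  obtain ⟨C, hC, h⟩ := ph_le_rpow (⌈u.re⌉+1)
  have ht : Filter.Tendsto (fun y : ℝ => C * y ^ (-(((⌈u.re⌉+1:ℤ):ℝ) - u.re))) Filter.atTop (nhds 0) := by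
    have hp : 0 < ((⌈u.re⌉+1:ℤ):ℝ) - u.re := by push_cast; linarith [Int.le_ceil u.re]
    have := (tendsto_rpow_neg_atTop hp).const_mul C
    rwa [mul_zero] at this
  refine squeeze_zero_norm' ?_ ht
  filter_upwards [Filter.eventually_gt_atTop 0] with y hy
  rw [norm_mul, Complex.norm_cpow_eq_rpow_re_of_pos hy, neg_sub, sub_eq_add_neg, add_comm, Real.rpow_add hy, ← mul_assoc]
  gcongr
  exact h y hy

lemma hasDerivAt_cpow' (y : ℝ) (hy : 0 < y) (u : ℂ) :
    HasDerivAt (fun y : ℝ => (y:ℂ) ^ u) (u * (y:ℂ) ^ (u-1)) y := by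
  by_cases hu : u = 0
  · subst hu; simpa using hasDerivAt_const y (1:ℂ)
  · exact hasDerivAt_ofReal_cpow_const hy.ne' hu

lemma EE_rec (u : ℂ) : u * EE u = EE (u+1) - EE (u-1) := by
  have e1 : ∀ y ∈ Set.Ioi (0:ℝ), (y:ℂ) ^ (u + 1 - 1) • (ph y : ℂ) - (y:ℂ) ^ (u - 1 - 1) • (ph y : ℂ)
      = - ((((-1 + 1/y^2) * ph y : ℝ) : ℂ) * (y:ℂ) ^ u) := by
    intro y hy
    have hy' : (y:ℂ) ≠ 0 := by exact_mod_cast (ne_of_gt hy)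
    rw [show u - 1 - 1 = u - ((2:ℕ):ℂ) by push_cast; ring, Complex.cpow_sub u _ hy', Complex.cpow_natCast]
    simp
    field_simp
    ring
  have h1 := EE_conv (u+1)
  have h2 := EE_conv (u-1)
  have h3 := EE_conv u
  have key := integral_Ioi_mul_deriv_eq_deriv_mul (a := (0:ℝ)) (v := fun y : ℝ => (y:ℂ) ^ u)
      (v' := fun y : ℝ => u * (y:ℂ) ^ (u-1))
      (u := fun y : ℝ => (ph y : ℂ)) (u' := fun y : ℝ => (((-1 + 1/y^2) * ph y : ℝ) : ℂ)) (a' := 0) (b' := 0)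
      (fun x hx => (ph_hasDerivAt x hx).ofReal_comp) (fun x hx => hasDerivAt_cpow' x hx u) ?_ ?_
      (zpow_ph_tendsto_zero u) (zpow_ph_tendsto_top u)
  · unfold EE mellin
    rw [← integral_sub h1 h2, setIntegral_congr_fun measurableSet_Ioi e1, integral_neg, ← integral_const_mul]
    rw [sub_self, zero_sub] at key
    rw [← key]
    refine setIntegral_congr_fun measurableSet_Ioi fun y hy => ?_
    simp only [smul_eq_mul]; ring
  · refine IntegrableOn.congr_fun (h3.const_mul u) (fun y hy => ?_) measurableSet_Ioi
    simp only [smul_eq_mul, Pi.mul_apply]; ring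
  · refine IntegrableOn.congr_fun (h1.sub h2).neg (fun y hy => ?_) measurableSet_Ioi
    have := e1 y hy
    simp only [Pi.neg_apply, Pi.sub_apply, Pi.mul_apply]
    rw [this, neg_neg]

lemma EE_decay (q : ℕ) : ∀ a b : ℝ, ∃ C : ℝ, 0 ≤ C ∧ ∀ u : ℂ, a ≤ u.re → u.re ≤ b →
    (1 + ‖u‖) ^ q * ‖EE u‖ ≤ C := by
  induction q with
  | zero => intro a b; simpa using EE_bdd a b
  | succ q ih =>
    intro a b
    obtain ⟨C, hC, h⟩ := ih (a-1) (b+1)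
    refine ⟨C + 2^q * C + 2^q * C, by positivity, fun u h1 h2 => ?_⟩
    have k0 := h u (by linarith) (by linarith)
    have k1 := h (u+1) (by simp; linarith) (by simp; linarith)
    have k2 := h (u-1) (by simp; linarith) (by simp; linarith)
    have n1 : 1 + ‖u‖ ≤ 2 * (1 + ‖u+1‖) := by
      have := norm_sub_le (u+1) 1
      simp at this; linarith [norm_nonneg (u+1)]
    have n2 : 1 + ‖u‖ ≤ 2 * (1 + ‖u-1‖) := by
      have := norm_add_le (u-1) 1
      simp at this; linarith [norm_nonneg (u-1)]
    have hr : ‖u‖ * ‖EE u‖ ≤ ‖EE (u+1)‖ + ‖EE (u-1)‖ := by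
      rw [← norm_mul, EE_rec]; exact norm_sub_le _ _
    calc (1 + ‖u‖) ^ (q+1) * ‖EE u‖ = (1+‖u‖)^q * ‖EE u‖ + (1+‖u‖)^q * (‖u‖ * ‖EE u‖) := by ring
      _ ≤ (1+‖u‖)^q * ‖EE u‖ + (1+‖u‖)^q * (‖EE (u+1)‖ + ‖EE (u-1)‖) := by gcongr
      _ = (1+‖u‖)^q * ‖EE u‖ + (1+‖u‖)^q * ‖EE (u+1)‖ + (1+‖u‖)^q * ‖EE (u-1)‖ := by ring
      _ ≤ (1+‖u‖)^q * ‖EE u‖ + (2 * (1 + ‖u+1‖))^q * ‖EE (u+1)‖ + (2 * (1 + ‖u-1‖))^q * ‖EE (u-1)‖ := by gcongr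
      _ = (1+‖u‖)^q * ‖EE u‖ + 2^q * ((1 + ‖u+1‖)^q * ‖EE (u+1)‖) + 2^q * ((1 + ‖u-1‖)^q * ‖EE (u-1)‖) := by
        rw [mul_pow, mul_pow]; ring
      _ ≤ _ := by gcongr

/-- normalising constant -/
noncomputable def cc : ℝ := ∫ y in Set.Ioi (0 : ℝ), Real.exp (-y - 1/y) / y

lemma ph0_integrable : IntegrableOn (fun y : ℝ => Real.exp (-y - 1/y) / y) (Set.Ioi 0) := by
  refine IntegrableOn.congr_fun (phr_integrable 0) (fun y hy => ?_) measurableSet_Ioi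
  simp only [zero_sub, Real.rpow_neg_one, ph]; ring

lemma cc_pos : 0 < cc := by
  unfold cc
  rw [setIntegral_pos_iff_support_of_nonneg_ae _ ph0_integrable]
  · have : Function.support (fun y : ℝ => Real.exp (-y - 1/y) / y) ∩ Set.Ioi 0 = Set.Ioi 0 := by
      apply Set.inter_eq_right.2
      intro y hy
      have : (0:ℝ) < y := hy
      simp [this.ne', Real.exp_ne_zero]
    rw [this]; simp
  · filter_upwards [ae_restrict_mem measurableSet_Ioi] with y hy
    have : (0:ℝ) < y := hy
    simp only [Pi.zero_apply]; positivity

lemma Fcut_nonneg (x : ℝ) (hx : 0 < x) : 0 ≤ Fcut x := by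
  unfold Fcut
  apply div_nonneg
  · refine setIntegral_nonneg measurableSet_Ioi fun y hy => ?_
    have : 0 < y := lt_trans hx hy
    positivity
  · exact cc_pos.le

lemma Fcut_hasDerivAt (x : ℝ) (hx : 0 < x) : HasDerivAt Fcut (-(ph x / x) / cc) x := by
  have hi : ∀ a : ℝ, 0 < a → IntegrableOn (fun y : ℝ => Real.exp (-y - 1/y) / y) (Set.Ioi a) :=
    fun a ha => ph0_integrable.mono_set (Set.Ioi_subset_Ioi ha.le)
  have hc : ContinuousOn (fun y : ℝ => Real.exp (-y - 1/y) / y) (Set.Ioi 0) := by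
    have := ph_continuousOn.div continuousOn_id (fun y (hy : (0:ℝ) < y) => hy.ne')
    exact this
  have hd : HasDerivAt (fun z => ∫ y in (x/2)..z, Real.exp (-y - 1/y) / y) (ph x / x) x := by
    refine intervalIntegral.integral_hasDerivAt_right ?_ ?_ ?_
    · rw [intervalIntegrable_iff_integrableOn_Ioc_of_le (by linarith)]
      exact (hi (x/2) (by positivity)).mono_set Set.Ioc_subset_Ioi_self
    · exact hc.stronglyMeasurableAtFilter isOpen_Ioi _ hx
    · exact hc.continuousAt (Ioi_mem_nhds hx)
  have he : Fcut =ᶠ[nhds x] fun z => ((∫ y in Set.Ioi (x/2), Real.exp (-y - 1/y) / y) -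
      ∫ y in (x/2)..z, Real.exp (-y - 1/y) / y) / cc := by
    filter_upwards [Ioi_mem_nhds (show x/2 < x by linarith)] with z hz
    have hz' : x/2 < z := hz
    have := intervalIntegral.integral_Ioi_sub_Ioi (hi (x/2) (by positivity)) hz'.le
    rw [← this]; unfold Fcut cc; ring_nf
  refine HasDerivAt.congr_of_eventuallyEq ?_ he
  have := (hd.const_sub (∫ y in Set.Ioi (x/2), Real.exp (-y - 1/y) / y)).div_const cc
  exact this

lemma Fcut_bound (p : ℕ) (z : ℝ) (hz : 0 < z) :
    z ^ p * Fcut z ≤ (∫ y in Set.Ioi (0:ℝ), y ^ ((p:ℝ)-1) * ph y) / cc := by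
  unfold Fcut
  rw [← mul_div_assoc]
  change _ / cc ≤ _
  have := cc_pos
  gcongr
  rw [← integral_const_mul]
  have hi := phr_integrable p
  calc _ ≤ ∫ y in Set.Ioi z, y ^ ((p:ℝ)-1) * ph y := by
        refine setIntegral_mono_on ?_ (hi.mono_set (Set.Ioi_subset_Ioi hz.le)) measurableSet_Ioi ?_
        · exact (ph0_integrable.mono_set (Set.Ioi_subset_Ioi hz.le)).const_mul _
        · intro y hy
          have hy' : z < y := hy
          have hy0 : 0 < y := hz.trans hy'
          have : y ^ ((p:ℝ)-1) = y ^ p / y := by rw [Real.rpow_sub_one hy0.ne', Real.rpow_natCast]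
          rw [this, ph, mul_div_assoc', div_mul_eq_mul_div]
          gcongr
    _ ≤ _ := by
      refine setIntegral_mono_set hi ?_ (Set.Ioi_subset_Ioi hz.le).eventuallyLE
      filter_upwards [ae_restrict_mem measurableSet_Ioi] with y hy
      have : (0:ℝ) < y := hy
      have := ph_pos y
      simp only [Pi.zero_apply]; positivity

lemma Fcut_bound' (p : ℕ) : ∃ C : ℝ, 0 ≤ C ∧ ∀ z : ℝ, 0 < z → z ^ p * ‖(Fcut z : ℂ)‖ ≤ C := by
  refine ⟨(∫ y in Set.Ioi (0:ℝ), y ^ ((p:ℝ)-1) * ph y) / cc, ?_, fun z hz => ?_⟩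
  rotate_left
  · rw [Complex.norm_real, Real.norm_of_nonneg (Fcut_nonneg z hz)]
    exact Fcut_bound p z hz
  · have := Fcut_bound p 1 one_pos
    have := Fcut_nonneg 1 one_pos
    rw [one_pow, one_mul] at *; linarith

lemma Ftilde_eq (u : ℂ) (hu : 0 < u.re) : Ftilde u = EE u / (u * cc) := by
  have hu0 : u ≠ 0 := by rintro rfl; simp at hu
  have hcc : (cc:ℂ) ≠ 0 := by exact_mod_cast cc_pos.ne'
  have hFc : ContinuousOn (fun y : ℝ => (Fcut y : ℂ)) (Set.Ioi 0) := fun z hz =>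
    ((Fcut_hasDerivAt z hz).ofReal_comp).continuousAt.continuousWithinAt
  obtain ⟨C0, hC0, h0⟩ := Fcut_bound' 0
  have hO : ∀ n : ℕ, (fun y : ℝ => (Fcut y : ℂ)) =O[Filter.atTop] fun x => x ^ (-(n:ℝ)) := by
    intro n
    obtain ⟨C, hC, h⟩ := Fcut_bound' n
    refine Asymptotics.IsBigO.of_bound C ?_
    filter_upwards [Filter.eventually_gt_atTop 0] with z hz
    rw [Real.norm_of_nonneg (by positivity), Real.rpow_neg hz.le, Real.rpow_natCast, ← div_eq_mul_inv,
      le_div_iff₀ (by positivity)]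
    linarith [h z hz]
  have hconv : MellinConvergent (fun y : ℝ => (Fcut y : ℂ)) u := by
    refine mellinConvergent_of_isBigO_rpow (a := ((⌈u.re⌉₊+1:ℕ):ℝ)) (b := 0) 
      (hFc.locallyIntegrableOn measurableSet_Ioi) (hO _) ?_ ?_ hu
    · push_cast; linarith [Nat.le_ceil u.re]
    · refine Asymptotics.IsBigO.of_bound C0 ?_
      filter_upwards [self_mem_nhdsWithin] with z hz
      simpa using h0 z hz
  have h3 := EE_conv u
  have e1 : ∀ y ∈ Set.Ioi (0:ℝ), ((-(ph y / y) / cc : ℝ) : ℂ) * (y:ℂ) ^ u = -(1/(cc:ℂ)) * ((y:ℂ) ^ (u-1) • (ph y : ℂ)) := by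
    intro y hy
    have hy' : (y:ℂ) ≠ 0 := by exact_mod_cast (ne_of_gt hy)
    rw [Complex.cpow_sub _ _ hy', smul_eq_mul, Complex.cpow_one]
    push_cast; field_simp
  have key := integral_Ioi_mul_deriv_eq_deriv_mul (a := (0:ℝ)) (v := fun y : ℝ => (y:ℂ) ^ u)
      (v' := fun y : ℝ => u * (y:ℂ) ^ (u-1))
      (u := fun y : ℝ => (Fcut y : ℂ)) (u' := fun y : ℝ => ((-(ph y / y) / cc : ℝ) : ℂ)) (a' := 0) (b' := 0)
      (fun x hx => (Fcut_hasDerivAt x hx).ofReal_comp) (fun x hx => hasDerivAt_cpow' x hx u) ?_ ?_ ?_ ?_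
  · rw [setIntegral_congr_fun measurableSet_Ioi e1, integral_const_mul] at key
    have : ∫ x in Set.Ioi (0:ℝ), (Fcut x : ℂ) * (u * (x:ℂ) ^ (u-1)) = u * Ftilde u := by
      unfold Ftilde; rw [← integral_const_mul]
      refine setIntegral_congr_fun measurableSet_Ioi fun y hy => ?_
      ring
    rw [this] at key
    change _ = 0 - 0 - -(1/(cc:ℂ)) * EE u at key
    rw [eq_div_iff (mul_ne_zero hu0 hcc)]
    linear_combination (cc:ℂ) * key + EE u * (mul_one_div_cancel hcc)
  · refine IntegrableOn.congr_fun (hconv.const_mul u) (fun y hy => ?_) measurableSet_Ioi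
    simp only [smul_eq_mul, Pi.mul_apply]; ring
  · refine IntegrableOn.congr_fun (h3.const_mul (-(1/(cc:ℂ)))) (fun y hy => ?_) measurableSet_Ioi
    exact (e1 y hy).symm
  · have ht : Filter.Tendsto (fun y : ℝ => C0 * y ^ u.re) (nhdsWithin 0 (Set.Ioi 0)) (nhds 0) := by
      have := (Real.continuousAt_rpow_const 0 _ (Or.inr hu.le)).tendsto.const_mul C0
      rw [Real.zero_rpow hu.ne', mul_zero] at this
      exact this.mono_left nhdsWithin_le_nhds
    refine squeeze_zero_norm' ?_ ht
    filter_upwards [self_mem_nhdsWithin] with y hy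
    have hy' : 0 < y := hy
    simp only [Pi.mul_apply]
    rw [norm_mul, Complex.norm_cpow_eq_rpow_re_of_pos hy]
    gcongr
    simpa using h0 y hy
  · obtain ⟨C, hC, h⟩ := Fcut_bound' (⌈u.re⌉₊+1)
    have hp : 0 < ((⌈u.re⌉₊+1:ℕ):ℝ) - u.re := by push_cast; linarith [Nat.le_ceil u.re]
    have ht := (tendsto_rpow_neg_atTop hp).const_mul C
    rw [mul_zero] at ht
    refine squeeze_zero_norm' ?_ ht
    filter_upwards [Filter.eventually_gt_atTop 0] with y hy
    simp only [Pi.mul_apply]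
    rw [norm_mul, Complex.norm_cpow_eq_rpow_re_of_pos hy, neg_sub, Real.rpow_sub hy, Real.rpow_natCast,
      mul_div_assoc', le_div_iff₀ (by positivity)]
    have := h y hy
    have := mul_le_mul_of_nonneg_right this (Real.rpow_pos_of_pos hy u.re).le
    linarith


noncomputable def RR (u : ℂ) : ℂ := Complex.Gamma ((1+u)/2) * (Complex.Gamma ((2-u)/2))⁻¹

lemma inv_Gamma_shift (s : ℂ) (n : ℕ) :
    (Complex.Gamma s)⁻¹ = (∏ i ∈ Finset.range n, (s + i)) * (Complex.Gamma (s+n))⁻¹ := by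
  induction n with
  | zero => simp
  | succ n ih =>
    rw [ih, Finset.prod_range_succ, Complex.one_div_Gamma_eq_self_mul_one_div_Gamma_add_one (s+n)]
    push_cast
    rw [← add_assoc]; ring

lemma beta_bound : ∃ C : ℝ, 0 ≤ C ∧ ∀ z b : ℂ, 1 ≤ z.re → 1/2 ≤ b.re → ‖Complex.betaIntegral z b‖ ≤ C := by
  have hi : IntervalIntegrable (fun x : ℝ => (1 - x) ^ (-(1/2) : ℝ)) volume 0 1 := by
    have := (intervalIntegral.intervalIntegrable_rpow' (a := 0) (b := 1) (r := -(1/2)) (by norm_num)).comp_sub_left 1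
    simpa using this.symm
  refine ⟨∫ x in (0:ℝ)..1, (1 - x) ^ (-(1/2) : ℝ), ?_, fun z b hz hb => ?_⟩
  · refine intervalIntegral.integral_nonneg (by norm_num) fun x hx => ?_
    exact Real.rpow_nonneg (by linarith [hx.2]) _
  · unfold Complex.betaIntegral
    refine intervalIntegral.norm_integral_le_of_norm_le (by norm_num) ?_ hi
    have : ∀ᵐ x : ℝ, x ≠ 1 := by simp [ae_iff]
    filter_upwards [this] with x hx1 hx
    have h0 : 0 < x := hx.1
    have h1 : 0 < 1 - x := by
      have := lt_of_le_of_ne hx.2 hx1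
      linarith
    rw [norm_mul, Complex.norm_cpow_eq_rpow_re_of_pos h0,
      show (1 - (x:ℂ)) = ((1 - x : ℝ) : ℂ) by push_cast; ring, Complex.norm_cpow_eq_rpow_re_of_pos h1]
    have a1 : x ^ (z - 1).re ≤ 1 := Real.rpow_le_one h0.le hx.2 (by simpa using hz)
    have a2 : (1 - x) ^ (b-1).re ≤ (1-x) ^ (-(1/2) : ℝ) := 
      Real.rpow_le_rpow_of_exponent_ge h1 (by linarith) (by simp; linarith)
    calc _ ≤ 1 * (1-x) ^ (-(1/2) : ℝ) := by gcongr
      _ = _ := one_mul _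

lemma RR_bound (n : ℕ) : ∃ C : ℝ, 0 ≤ C ∧ ∀ u : ℂ, 1 ≤ u.re → u.re ≤ n → ‖RR u‖ ≤ C * (1 + ‖u‖) ^ n := by
  obtain ⟨B, hB, hb⟩ := beta_bound
  have hc : ContinuousOn (fun b : ℝ => (Complex.Gamma b)⁻¹) (Set.Icc (1/2) n) :=
    (Complex.differentiable_one_div_Gamma.continuous.comp Complex.continuous_ofReal).continuousOn
  obtain ⟨K, hK⟩ := isCompact_Icc.exists_bound_of_continuousOn hc
  refine ⟨(1 + n)^n * (B * |K|), by positivity, fun u h1 h2 => ?_⟩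
  set s : ℂ := (starRingEnd ℂ) ((2-u)/2) with hs
  set β : ℝ := n - u.re + 1/2 with hβ
  have hβ0 : 1/2 ≤ β := by rw [hβ]; linarith
  have hβ1 : β ≤ n := by rw [hβ]; linarith
  have hsn : s + n = (1+u)/2 + β := by
    apply Complex.ext
    · rw [hs, Complex.add_re, Complex.conj_re]; simp [hβ]; ring
    · rw [hs, Complex.add_im, Complex.conj_im]; simp; ring
  have hg : ‖(Complex.Gamma ((2-u)/2))⁻¹‖ = ‖(Complex.Gamma s)⁻¹‖ := by
    rw [hs, Complex.Gamma_conj, norm_inv, norm_inv, RCLike.norm_conj]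
  have hbeta := Complex.Gamma_mul_Gamma_eq_betaIntegral (s := (1+u)/2) (t := (β:ℂ)) (by simp; linarith) (by simp; linarith)
  have hG1 : Complex.Gamma ((1+u)/2 + β) ≠ 0 := Complex.Gamma_ne_zero_of_re_pos (by simp; linarith)
  have hG2 : Complex.Gamma β ≠ 0 := Complex.Gamma_ne_zero_of_re_pos (by simp; linarith)
  have hq : Complex.Gamma ((1+u)/2) * (Complex.Gamma ((1+u)/2 + β))⁻¹ = 
      Complex.betaIntegral ((1+u)/2) β * (Complex.Gamma β)⁻¹ := by
    rw [← div_eq_mul_inv, ← div_eq_mul_inv, div_eq_div_iff hG1 hG2, hbeta, mul_comm]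
  have hprod : ‖∏ i ∈ Finset.range n, (s + i)‖ ≤ ((1+n) * (1 + ‖u‖))^n := by
    rw [norm_prod]
    calc _ ≤ ∏ i ∈ Finset.range n, ((1+n) * (1 + ‖u‖)) := by
          refine Finset.prod_le_prod (fun _ _ => norm_nonneg _) fun i hi => ?_
          have hi' : (i:ℝ) ≤ n := by exact_mod_cast (Finset.mem_range.1 hi).le
          have : ‖s‖ ≤ 1 + ‖u‖ := by
            rw [hs, RCLike.norm_conj, norm_div]
            have := norm_sub_le 2 u
            simp at *
            linarith [norm_nonneg u]
          have h3 := norm_add_le s i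
          have h4 : ‖(i:ℂ)‖ = i := by simp
          nlinarith [norm_nonneg u, (Nat.cast_nonneg n : (0:ℝ) ≤ n)]
      _ = _ := by simp
  calc ‖RR u‖ = ‖Complex.Gamma ((1+u)/2)‖ * ‖(Complex.Gamma s)⁻¹‖ := by rw [RR, norm_mul, hg]
    _ = ‖∏ i ∈ Finset.range n, (s + i)‖ * ‖Complex.Gamma ((1+u)/2) * (Complex.Gamma ((1+u)/2 + β))⁻¹‖ := by
      rw [inv_Gamma_shift s n, hsn, norm_mul, norm_mul]; ring
    _ = ‖∏ i ∈ Finset.range n, (s + i)‖ * (‖Complex.betaIntegral ((1+u)/2) β‖ * ‖(Complex.Gamma β)⁻¹‖) := by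
      rw [hq, norm_mul]
    _ ≤ ((1+n) * (1 + ‖u‖))^n * (B * |K|) := by
      gcongr
      · exact hb _ _ (by simp; linarith) (by simpa using hβ0)
      · exact (hK β ⟨hβ0, hβ1⟩).trans (le_abs_self K)
    _ = _ := by rw [mul_pow]; ring

lemma RR_diff (u : ℂ) (hu : 0 < u.re) : DifferentiableAt ℂ RR u := by
  unfold RR
  have h1 : DifferentiableAt ℂ Complex.Gamma ((1+u)/2) := by
    refine Complex.differentiableAt_Gamma _ fun m h => ?_
    have := congrArg Complex.re h
    simp at this
    have : (0:ℝ) ≤ m := Nat.cast_nonneg m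
    linarith
  have h2 : DifferentiableAt ℂ (fun u => Complex.Gamma ((1+u)/2)) u := 
    h1.comp u (f := fun u : ℂ => (1+u)/2) (by fun_prop)
  have h3 : DifferentiableAt ℂ (fun u => (Complex.Gamma ((2-u)/2))⁻¹) u :=
    (Complex.differentiable_one_div_Gamma ((2-u)/2)).comp u (f := fun u : ℂ => (2-u)/2) (by fun_prop)
  exact h2.mul h3

lemma inv_sq_tendsto (C : ℝ) : Filter.Tendsto (fun T : ℝ => C * (1 + T^2)⁻¹) Filter.atTop (nhds 0) := by
  have h : Filter.Tendsto (fun T : ℝ => 1 + T^2) Filter.atTop Filter.atTop :=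
    Filter.tendsto_atTop_add_const_left _ _ (Filter.tendsto_pow_atTop two_ne_zero)
  simpa using h.inv_tendsto_atTop.const_mul C

lemma vline_integrable (f : ℂ → ℂ) (a C : ℝ) 
    (hd : ∀ u : ℂ, u.re = a → ContinuousAt f u)
    (hb : ∀ u : ℂ, u.re = a → ‖f u‖ ≤ C * (1 + u.im^2)⁻¹) :
    Integrable (fun t : ℝ => f (a + t * Complex.I)) := by
  refine Integrable.mono' (integrable_inv_one_add_sq.const_mul C) ?_ ?_
  · apply Continuous.aestronglyMeasurable
    rw [continuous_iff_continuousAt]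
    intro t
    exact ContinuousAt.comp (f := fun t : ℝ => (a:ℂ) + t * Complex.I) (hd _ (by simp)) (by fun_prop)
  · refine Filter.Eventually.of_forall fun t => ?_
    simpa using hb (a + t * Complex.I) (by simp)

lemma contour_shift (f : ℂ → ℂ) (a b C : ℝ) (hab : a ≤ b)
    (hd : ∀ u : ℂ, a ≤ u.re → u.re ≤ b → DifferentiableAt ℂ f u)
    (hb : ∀ u : ℂ, a ≤ u.re → u.re ≤ b → ‖f u‖ ≤ C * (1 + u.im^2)⁻¹) :
    ∫ t : ℝ, f (a + t * Complex.I) = ∫ t : ℝ, f (b + t * Complex.I) := by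
  have i1 := vline_integrable f a C (fun u h => (hd u h.ge (h.trans_le hab)).continuousAt) (fun u h => hb u h.ge (h.trans_le hab))
  have i2 := vline_integrable f b C (fun u h => (hd u (hab.trans h.ge) h.le).continuousAt) (fun u h => hb u (hab.trans h.ge) h.le)
  have t1 := intervalIntegral_tendsto_integral i1 Filter.tendsto_neg_atTop_atBot Filter.tendsto_id
  have t2 := intervalIntegral_tendsto_integral i2 Filter.tendsto_neg_atTop_atBot Filter.tendsto_id
  have hz : ∀ s : ℝ → ℝ, (∀ T, (s T)^2 = T^2) → 
      Filter.Tendsto (fun T : ℝ => ∫ x in a..b, f (x + (s T : ℝ) * Complex.I)) Filter.atTop (nhds 0) := by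
    intro s hs
    refine squeeze_zero_norm (a := fun T => (C * |b - a|) * (1 + T^2)⁻¹) (fun T => ?_) (inv_sq_tendsto _)
    have := intervalIntegral.norm_integral_le_of_norm_le_const (a := a) (b := b) (C := C * (1 + T^2)⁻¹)
      (f := fun x : ℝ => f (x + (s T : ℝ) * Complex.I)) (fun x hx => ?_)
    · linarith
    · rw [Set.uIoc_of_le hab] at hx
      have := hb (x + (s T : ℝ) * Complex.I) (by simpa using hx.1.le) (by simpa using hx.2)
      simpa [hs T] using this
  have h1 := hz (fun T => -T) (fun T => by ring)
  have h2 := hz (fun T => T) (fun T => rfl)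
  have hrect : ∀ T : ℝ, (∫ x in a..b, f (x + ((-T : ℝ):ℂ) * Complex.I)) - (∫ x in a..b, f (x + (T:ℂ) * Complex.I))
      + Complex.I • (∫ y in (-T)..T, f (b + y * Complex.I)) - Complex.I • (∫ y in (-T)..T, f (a + y * Complex.I)) = 0 := by
    intro T
    have := Complex.integral_boundary_rect_eq_zero_of_differentiableOn f (a + (-T : ℝ) * Complex.I) (b + T * Complex.I) ?_
    · simpa using this
    · intro u hu
      have h := hu.1
      simp [Set.uIcc_of_le hab] at h
      exact (hd u h.1 h.2).differentiableWithinAt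
  have hlim := ((h1.sub h2).add (t2.const_smul Complex.I)).sub (t1.const_smul Complex.I)
  have : (fun _ : ℝ => (0:ℂ)) = fun T : ℝ => (∫ x in a..b, f (x + ((-T : ℝ):ℂ) * Complex.I)) - (∫ x in a..b, f (x + (T:ℂ) * Complex.I))
      + Complex.I • (∫ y in (-T)..T, f (b + y * Complex.I)) - Complex.I • (∫ y in (-T)..T, f (a + y * Complex.I)) := by
    funext T; exact (hrect T).symm
  have h0 := tendsto_nhds_unique hlim (this ▸ tendsto_const_nhds)
  simp only [sub_self, zero_add, smul_eq_mul] at h0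
  rw [← mul_sub] at h0
  have := (mul_eq_zero.1 h0).resolve_left Complex.I_ne_zero
  exact (sub_eq_zero.1 this).symm


def Fam (p : ℕ) (Ψ : ℕ → ℝ → ℂ) : Prop :=
  (∀ j z, 0 < z → HasDerivAt (Ψ j) (Ψ (j+1) z / z) z) ∧
    ∀ j, ∃ C : ℝ, 0 ≤ C ∧ ∀ z : ℝ, 0 < z → z ^ p * ‖Ψ j z‖ ≤ C

lemma Fam.add {p : ℕ} {Ψ Θ : ℕ → ℝ → ℂ} (h1 : Fam p Ψ) (h2 : Fam p Θ) : Fam p (fun j z => Ψ j z + Θ j z) := by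
  refine ⟨fun j z hz => ?_, fun j => ?_⟩
  · have := (h1.1 j z hz).add (h2.1 j z hz)
    rw [← add_div] at this
    exact this
  · obtain ⟨C, hC, h⟩ := h1.2 j
    obtain ⟨D, hD, h'⟩ := h2.2 j
    refine ⟨C + D, by positivity, fun z hz => ?_⟩
    calc _ ≤ z^p * (‖Ψ j z‖ + ‖Θ j z‖) := by gcongr; exact norm_add_le _ _
      _ ≤ _ := by linarith [h z hz, h' z hz]

noncomputable def TT : ℕ → ℤ → ℝ → ℝ
  | 0, a, z => z ^ a * ph z
  | j+1, a, z => a * TT j a z - TT j (a+1) z + TT j (a-1) z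

lemma TT_deriv (j : ℕ) : ∀ (a : ℤ) (z : ℝ), 0 < z → HasDerivAt (TT j a) (TT (j+1) a z / z) z := by
  induction j with
  | zero =>
    intro a z hz
    have h := (hasDerivAt_zpow a z (Or.inl hz.ne')).mul (ph_hasDerivAt z hz)
    have e : TT 0 a = fun z => z ^ a * ph z := by funext z; rfl
    rw [e]
    refine HasDerivAt.congr_deriv h ?_
    simp only [TT]
    rw [zpow_add_one₀ hz.ne', zpow_sub_one₀ hz.ne']
    field_simp
    ring
  | succ j ih =>
    intro a z hz
    have h := (((ih a z hz).const_mul (a:ℝ)).sub (ih (a+1) z hz)).add (ih (a-1) z hz)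
    have e : TT (j+1) a = fun z => a * TT j a z - TT j (a+1) z + TT j (a-1) z := by funext z; rfl
    rw [e]
    refine HasDerivAt.congr_deriv h ?_
    rw [show TT (j+1+1) a z = a * TT (j+1) a z - TT (j+1) (a+1) z + TT (j+1) (a-1) z from rfl]
    ring

lemma TT_bound (p : ℕ) (j : ℕ) : ∀ (a : ℤ), ∃ C : ℝ, 0 ≤ C ∧ ∀ z : ℝ, 0 < z → z ^ p * |TT j a z| ≤ C := by
  induction j with
  | zero =>
    intro a
    obtain ⟨C, hC, h⟩ := ph_bound (p + a)
    refine ⟨C, hC, fun z hz => ?_⟩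
    have h1 := h z hz
    have := ph_pos z
    rw [zpow_add₀ hz.ne', zpow_natCast] at h1
    simp only [TT]
    rw [abs_of_nonneg (by positivity)]
    linarith
  | succ j ih =>
    intro a
    obtain ⟨C0, hC0, h0⟩ := ih a
    obtain ⟨C1, hC1, h1⟩ := ih (a+1)
    obtain ⟨C2, hC2, h2⟩ := ih (a-1)
    refine ⟨|(a:ℝ)| * C0 + C1 + C2, by positivity, fun z hz => ?_⟩
    simp only [TT]
    have : |a * TT j a z - TT j (a+1) z + TT j (a-1) z| ≤ |(a:ℝ)| * |TT j a z| + |TT j (a+1) z| + |TT j (a-1) z| := by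
      rw [← abs_mul]
      exact (abs_add_le _ _).trans (by gcongr; exact abs_sub _ _)
    calc _ ≤ z^p * (|(a:ℝ)| * |TT j a z| + |TT j (a+1) z| + |TT j (a-1) z|) := by gcongr
      _ = |(a:ℝ)| * (z^p * |TT j a z|) + z^p * |TT j (a+1) z| + z^p * |TT j (a-1) z| := by ring
      _ ≤ _ := by
        have := h0 z hz; have := h1 z hz; have := h2 z hz
        gcongr

noncomputable def FF : ℕ → ℝ → ℝ
  | 0, z => Fcut z
  | j+1, z => -(TT j 0 z) / cc

lemma FF_fam (p : ℕ) : Fam p (fun j z => (FF j z : ℂ)) := by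
  refine ⟨fun j z hz => ?_, fun j => ?_⟩
  · have : HasDerivAt (FF j) (FF (j+1) z / z) z := by
      cases j with
      | zero =>
        have := Fcut_hasDerivAt z hz
        have e : FF 0 = Fcut := by funext z; rfl
        rw [e]; refine HasDerivAt.congr_deriv this ?_
        simp [FF, TT]; field_simp
      | succ j =>
        have := (TT_deriv j 0 z hz).neg.div_const cc
        have e : FF (j+1) = fun z => -(TT j 0 z) / cc := by funext z; rfl
        rw [e]; refine HasDerivAt.congr_deriv this ?_
        simp only [FF]; ring
    have := this.ofReal_comp
    simpa using this
  · cases j with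
    | zero => exact Fcut_bound' p
    | succ j =>
      obtain ⟨C, hC, h⟩ := TT_bound p j 0
      have := cc_pos
      refine ⟨C / cc, by positivity, fun z hz => ?_⟩
      have := h z hz
      simp only [FF]
      rw [Complex.norm_real, norm_div, norm_neg, Real.norm_eq_abs, Real.norm_of_nonneg cc_pos.le, ← mul_div_assoc]
      gcongr

noncomputable def gg (u : ℂ) : ℂ := RR u * (Real.pi : ℂ) ^ (-u) * (EE u / (u * cc))

lemma gg_diff (u : ℂ) (hu : 0 < u.re) : DifferentiableAt ℂ gg u := by
  have hu0 : u ≠ 0 := by rintro rfl; simp at hu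
  have hcc : (cc:ℂ) ≠ 0 := by exact_mod_cast cc_pos.ne'
  have hpi : (Real.pi:ℂ) ≠ 0 := by exact_mod_cast Real.pi_ne_zero
  unfold gg
  refine ((RR_diff u hu).mul ?_).mul ((EE_diff u).div (by fun_prop) (mul_ne_zero hu0 hcc))
  exact (differentiableAt_id.neg).const_cpow (Or.inl hpi)

lemma gg_bound (n q : ℕ) : ∃ C : ℝ, 0 ≤ C ∧ ∀ u : ℂ, 1 ≤ u.re → u.re ≤ n → (1 + ‖u‖) ^ q * ‖gg u‖ ≤ C := by
  obtain ⟨C, hC, h⟩ := RR_bound n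
  obtain ⟨D, hD, h'⟩ := EE_decay (q + n) 1 n
  have hc := cc_pos
  refine ⟨C * D / cc, by positivity, fun u h1 h2 => ?_⟩
  have n1 : 1 ≤ ‖u‖ := h1.trans (Complex.re_le_norm u)
  have a1 := h u h1 h2
  have a2 := h' u h1 h2
  have a3 : ‖(Real.pi : ℂ) ^ (-u)‖ ≤ 1 := by
    rw [Complex.norm_cpow_eq_rpow_re_of_pos Real.pi_pos]
    exact Real.rpow_le_one_of_one_le_of_nonpos (by linarith [Real.two_le_pi]) (by simp; linarith)
  have a4 : ‖EE u / (u * cc)‖ ≤ ‖EE u‖ / cc := by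
    rw [norm_div, norm_mul, Complex.norm_real, Real.norm_of_nonneg hc.le]
    gcongr
    nlinarith
  unfold gg
  rw [norm_mul, norm_mul]
  calc _ ≤ (1 + ‖u‖) ^ q * ((C * (1 + ‖u‖) ^ n) * 1 * (‖EE u‖ / cc)) := by gcongr
    _ = C * ((1 + ‖u‖) ^ (q+n) * ‖EE u‖) / cc := by rw [pow_add]; ring
    _ ≤ _ := by gcongr

lemma gg_bound' (n j : ℕ) : ∃ C : ℝ, 0 ≤ C ∧ ∀ u : ℂ, 1 ≤ u.re → u.re ≤ n → 
    ‖(1 - u)^j * gg u‖ ≤ C * (1 + u.im^2)⁻¹ := by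
  obtain ⟨C, hC, h⟩ := gg_bound n (j+2)
  refine ⟨C, hC, fun u h1 h2 => ?_⟩
  rw [← div_eq_mul_inv, le_div_iff₀ (by positivity), norm_mul, norm_pow]
  have b1 : ‖1 - u‖ ≤ 1 + ‖u‖ := by simpa using norm_sub_le 1 u
  have b2 : 1 + u.im^2 ≤ (1 + ‖u‖)^2 := by
    have := Complex.abs_im_le_norm u
    have : u.im^2 ≤ ‖u‖^2 := by rw [← sq_abs u.im]; gcongr
    nlinarith [norm_nonneg u]
  calc _ ≤ (1 + ‖u‖)^j * ‖gg u‖ * (1 + ‖u‖)^2 := by gcongr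
    _ = (1 + ‖u‖)^(j+2) * ‖gg u‖ := by ring
    _ ≤ C := h u h1 h2

noncomputable def KK : ℂ := ((Real.sqrt Real.pi / (2 * Real.pi) : ℝ) : ℂ)

noncomputable def ZZ (p j : ℕ) (z : ℝ) : ℂ :=
  KK * ∫ t : ℝ, (1 - (((p + 1 : ℕ) : ℝ) + t * Complex.I))^j * gg (((p + 1 : ℕ) : ℝ) + t * Complex.I) *
    (z:ℂ) ^ (1 - (((p + 1 : ℕ) : ℝ) + t * Complex.I))

lemma norm_ZZint (p : ℕ) (z t : ℝ) (hz : 0 < z) :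
    ‖(z:ℂ) ^ (1 - (((p + 1 : ℕ) : ℝ) + t * Complex.I))‖ = (z ^ p)⁻¹ := by
  rw [Complex.norm_cpow_eq_rpow_re_of_pos hz]
  have : (1 - ((((p + 1 : ℕ) : ℝ):ℂ) + t * Complex.I)).re = -(p:ℝ) := by simp
  rw [this, Real.rpow_neg hz.le, Real.rpow_natCast]

lemma gline_cont (p j : ℕ) : Continuous (fun t : ℝ => (1 - (((p + 1 : ℕ) : ℝ) + t * Complex.I))^j * gg (((p + 1 : ℕ) : ℝ) + t * Complex.I)) := by
  refine Continuous.mul (by fun_prop) ?_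
  rw [continuous_iff_continuousAt]
  intro t
  refine ContinuousAt.comp (f := fun t : ℝ => (((p + 1 : ℕ) : ℝ):ℂ) + t * Complex.I) (gg_diff _ ?_).continuousAt (by fun_prop)
  simp; positivity

lemma zline_cont (p : ℕ) (z : ℝ) (hz : 0 < z) : Continuous (fun t : ℝ => (z:ℂ) ^ (1 - (((p + 1 : ℕ) : ℝ) + t * Complex.I))) := by
  have : (z:ℂ) ≠ 0 := by exact_mod_cast hz.ne'
  exact Continuous.const_cpow (by fun_prop) (Or.inl this)

lemma ZZ_fam (p : ℕ) : Fam p (ZZ p) := by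
  have hbd : ∀ j, ∃ C : ℝ, 0 ≤ C ∧ ∀ t : ℝ, ‖(1 - ((((p + 1 : ℕ) : ℝ):ℂ) + t * Complex.I))^j * gg (((p + 1 : ℕ) : ℝ) + t * Complex.I)‖ ≤ C * (1 + t^2)⁻¹ := by
    intro j
    obtain ⟨C, hC, h⟩ := gg_bound' (p+1) j
    refine ⟨C, hC, fun t => ?_⟩
    have := h (((p + 1 : ℕ) : ℝ) + t * Complex.I) (by simp) (by simp)
    simpa using this
  refine ⟨fun j z hz => ?_, fun j => ?_⟩
  · obtain ⟨C, hC, h⟩ := hbd j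
    obtain ⟨D, hD, h'⟩ := hbd (j+1)
    have hs : Set.Ioi (z/2) ∈ nhds z := Ioi_mem_nhds (by linarith)
    have key := hasDerivAt_integral_of_dominated_loc_of_deriv_le (μ := volume) (x₀ := z) (s := Set.Ioi (z/2))
      (bound := fun t => D * (1 + t^2)⁻¹ * (((z/2)^p)⁻¹ * (z/2)⁻¹))
      (F := fun (z t : ℝ) => (1 - (((p + 1 : ℕ) : ℝ) + t * Complex.I))^j * gg (((p + 1 : ℕ) : ℝ) + t * Complex.I) *
    (z:ℂ) ^ (1 - (((p + 1 : ℕ) : ℝ) + t * Complex.I)))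
      (F' := fun (z t : ℝ) => (1 - (((p + 1 : ℕ) : ℝ) + t * Complex.I))^(j+1) * gg (((p + 1 : ℕ) : ℝ) + t * Complex.I) *
    (z:ℂ) ^ (1 - (((p + 1 : ℕ) : ℝ) + t * Complex.I)) / z) hs ?_ ?_ ?_ ?_ ?_ ?_
    · have := key.2.const_mul KK
      unfold ZZ
      refine HasDerivAt.congr_deriv this ?_
      rw [integral_div]; ring
    · filter_upwards [Ioi_mem_nhds hz] with w hw
      exact ((gline_cont p j).mul (zline_cont p w hw)).aestronglyMeasurable
    · refine Integrable.mono' (g := fun t => C * (1 + t^2)⁻¹ * (z^p)⁻¹) ((integrable_inv_one_add_sq.const_mul C).mul_const _)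
        ((gline_cont p j).mul (zline_cont p z hz)).aestronglyMeasurable (Filter.Eventually.of_forall fun t => ?_)
      rw [norm_mul, norm_ZZint p z t hz]
      gcongr
      exact h t
    · exact (((gline_cont p (j+1)).mul (zline_cont p z hz)).div_const _).aestronglyMeasurable
    · refine Filter.Eventually.of_forall fun t w hw => ?_
      have hw' : z/2 < w := hw
      have hw0 : 0 < w := by linarith
      rw [norm_div, norm_mul, norm_ZZint p w t hw0, Complex.norm_real, Real.norm_of_nonneg hw0.le, div_eq_mul_inv, mul_assoc]
      gcongr
      exact h' t
    · exact (integrable_inv_one_add_sq.const_mul D).mul_const _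
    · refine Filter.Eventually.of_forall fun t w hw => ?_
      have hw' : z/2 < w := hw
      have hw0 : 0 < w := by linarith
      have hwc : (w:ℂ) ≠ 0 := by exact_mod_cast hw0.ne'
      have := (hasDerivAt_cpow' w hw0 (1 - (((p + 1 : ℕ) : ℝ) + t * Complex.I))).const_mul 
        ((1 - (((p + 1 : ℕ) : ℝ) + t * Complex.I))^j * gg (((p + 1 : ℕ) : ℝ) + t * Complex.I))
      refine HasDerivAt.congr_deriv this ?_
      rw [Complex.cpow_sub _ 1 hwc, Complex.cpow_one]
      ring
  · obtain ⟨C, hC, h⟩ := hbd j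
    have hint : Integrable (fun t : ℝ => C * (1 + t^2)⁻¹) := integrable_inv_one_add_sq.const_mul C
    refine ⟨‖KK‖ * ∫ t : ℝ, C * (1 + t^2)⁻¹, ?_, fun z hz => ?_⟩
    · have : 0 ≤ ∫ t : ℝ, C * (1 + t^2)⁻¹ := integral_nonneg fun t => by positivity
      positivity
    · have : ‖∫ t : ℝ, (1 - (((p + 1 : ℕ) : ℝ) + t * Complex.I))^j * gg (((p + 1 : ℕ) : ℝ) + t * Complex.I) *
    (z:ℂ) ^ (1 - (((p + 1 : ℕ) : ℝ) + t * Complex.I))‖ ≤ ∫ t : ℝ, C * (1 + t^2)⁻¹ * (z^p)⁻¹ := by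
        refine norm_integral_le_of_norm_le (hint.mul_const _) (Filter.Eventually.of_forall fun t => ?_)
        rw [norm_mul, norm_ZZint p z t hz]
        gcongr
        exact h t
      unfold ZZ
      rw [norm_mul]
      rw [integral_mul_const] at this
      have hzp : 0 < z^p := by positivity
      calc _ ≤ z^p * (‖KK‖ * ((∫ t : ℝ, C * (1 + t^2)⁻¹) * (z^p)⁻¹)) := by gcongr
        _ = _ := by field_simp

lemma ZZ_zero (p : ℕ) (y : ℝ) (hy : 0 < y) : ZZ p 0 y = y * Hfun y := by
  have hyc : (y:ℂ) ≠ 0 := by exact_mod_cast hy.ne'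
  obtain ⟨C, hC, h⟩ := gg_bound' (p+1) 0
  have hshift := contour_shift (fun u => gg u * (y:ℂ) ^ (1 - u)) 1 ((p+1 : ℕ):ℝ) (C * (y ^ (-(p:ℝ)) + y ^ (0:ℝ)))
    (by push_cast; linarith [(Nat.cast_nonneg p : (0:ℝ) ≤ p)]) ?_ ?_
  · unfold ZZ Hfun
    change _ = (y:ℂ) * (KK * _)
    simp only [pow_zero, one_mul]
    rw [← hshift, mul_left_comm]
    congr 1
    rw [← integral_const_mul]
    congr 1
    funext t
    have e1 : (1 + (1 + (t:ℂ) * Complex.I))/2 = (2 + (t:ℂ) * Complex.I)/2 := by ring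
    have e2 : (2 - (1 + (t:ℂ) * Complex.I))/2 = (1 - (t:ℂ) * Complex.I)/2 := by ring
    rw [Ftilde_eq _ (by simp), gg, RR]
    push_cast
    rw [e1, e2, sub_eq_add_neg 1 (1 + (t:ℂ) * Complex.I), Complex.cpow_add _ _ hyc, Complex.cpow_one]
    rw [Complex.mul_cpow_ofReal_nonneg Real.pi_pos.le hy.le]
    ring
  · intro u h1 h2
    refine (gg_diff u (by linarith)).mul ?_
    exact DifferentiableAt.const_cpow (by fun_prop) (Or.inl hyc)
  · intro u h1 h2
    have := h u h1 h2
    rw [pow_zero, one_mul] at this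
    rw [norm_mul, Complex.norm_cpow_eq_rpow_re_of_pos hy]
    have h3 : y ^ (1 - u).re ≤ y ^ (-(p:ℝ)) + y ^ (0:ℝ) := 
      rpow_le_add _ _ _ _ hy (by push_cast at h2; simp; linarith) (by simp; linarith)
    calc _ ≤ (C * (1 + u.im^2)⁻¹) * (y ^ (-(p:ℝ)) + y ^ (0:ℝ)) := by gcongr
      _ = _ := by ring

lemma exists_fam (p : ℕ) : ∃ Ψ : ℕ → ℝ → ℂ, Fam p Ψ ∧ ∀ z : ℝ, 0 < z → Ψ 0 z = (Fcut z : ℂ) + z * Hfun z := by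
  refine ⟨_, (FF_fam p).add (ZZ_fam p), fun z hz => ?_⟩
  simp only [ZZ_zero p z hz, FF]


noncomputable def rr (x : ℝ) : ℝ := Real.sqrt (1 - x^2)

lemma rr_pos {x : ℝ} (hx : x ∈ Set.Ioo (-1:ℝ) 1) : 0 < rr x := by
  unfold rr; apply Real.sqrt_pos.2; nlinarith [hx.1, hx.2]

lemma rr_sq {x : ℝ} (hx : x ∈ Set.Ioo (-1:ℝ) 1) : rr x ^ 2 = 1 - x^2 := by
  unfold rr; apply Real.sq_sqrt; nlinarith [hx.1, hx.2]

lemma rr_le_one (x : ℝ) : rr x ≤ 1 := by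
  unfold rr; exact Real.sqrt_le_iff.2 ⟨by norm_num, by nlinarith [sq_nonneg x]⟩

lemma rr_hasDerivAt {x : ℝ} (hx : x ∈ Set.Ioo (-1:ℝ) 1) : HasDerivAt rr (-x / rr x) x := by
  have h : HasDerivAt (fun x : ℝ => 1 - x^2) (-(2*x)) x := by
    have := (hasDerivAt_pow 2 x).const_sub 1
    refine this.congr_deriv ?_
    simp
  have := h.sqrt (by nlinarith [hx.1, hx.2])
  refine this.congr_deriv ?_
  have := rr_pos hx
  unfold rr at *
  field_simp

lemma rr_inv_int : IntervalIntegrable (fun x => (rr x)⁻¹) volume (-1) 1 := by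
  have := intervalIntegral.intervalIntegrable_deriv_of_nonneg (a := -1) (b := 1) (g := Real.arcsin)
    (g' := fun x => 1 / √(1 - x^2)) Real.continuous_arcsin.continuousOn ?_ ?_
  · simpa [rr] using this
  · intro x hx
    norm_num at hx
    exact Real.hasDerivAt_arcsin (by linarith) (by linarith)
  · intro x hx
    positivity

noncomputable def qq (Ψ : ℕ → ℝ → ℂ) (A ω : ℝ) (P : Polynomial ℂ) (b : ℤ) (j : ℕ) (x : ℝ) : ℂ :=
  P.eval (x:ℂ) * ((rr x ^ b : ℝ) : ℂ) * Ψ j (A / rr x) * Complex.exp (-(Complex.I * ω * x))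

open Polynomial in
lemma qq_deriv {Ψ : ℕ → ℝ → ℂ} {p : ℕ} (hΨ : Fam p Ψ) {A : ℝ} (hA : 0 < A) (ω : ℝ) (P : Polynomial ℂ) (b : ℤ) (j : ℕ)
    {x : ℝ} (hx : x ∈ Set.Ioo (-1:ℝ) 1) :
    HasDerivAt (qq Ψ A ω P b j) (qq Ψ A ω (derivative P * (1 - X^2) - C (b:ℂ) * X * P) (b-2) j x +
      qq Ψ A ω (X * P) (b-2) (j+1) x - Complex.I * ω * qq Ψ A ω P b j x) x := by
  have hr := rr_pos hx
  have hrc : (rr x : ℂ) ≠ 0 := by exact_mod_cast hr.ne'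
  have d1 : HasDerivAt (fun x : ℝ => P.eval (x:ℂ)) ((derivative P).eval (x:ℂ)) x :=
    (P.hasDerivAt (x:ℂ)).comp_ofReal
  have d2 : HasDerivAt (fun x : ℝ => ((rr x ^ b : ℝ) : ℂ)) ((b * rr x ^ (b-1) * (-x / rr x) : ℝ) : ℂ) x :=
    ((hasDerivAt_zpow b (rr x) (Or.inl hr.ne')).comp x (rr_hasDerivAt hx)).ofReal_comp
  have d3 : HasDerivAt (fun x : ℝ => A / rr x) ((A / rr x) * (x / rr x ^ 2)) x := by
    have := ((rr_hasDerivAt hx).inv hr.ne').const_mul A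
    refine this.congr_deriv ?_
    field_simp
  have d4 : HasDerivAt (fun x : ℝ => Ψ j (A / rr x)) (Ψ (j+1) (A / rr x) * (x / rr x ^ 2 : ℝ)) x := by
    have hz : 0 < A / rr x := by positivity
    have := HasDerivAt.scomp x (hΨ.1 j (A / rr x) hz) d3
    refine this.congr_deriv ?_
    have hzc : ((A / rr x : ℝ) : ℂ) ≠ 0 := by exact_mod_cast hz.ne'
    rw [Complex.real_smul, Complex.ofReal_mul]
    field_simp
  have d5 : HasDerivAt (fun x : ℝ => Complex.exp (-(Complex.I * ω * x))) 
      (Complex.exp (-(Complex.I * ω * x)) * (-(Complex.I * ω))) x := by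
    have h : HasDerivAt (fun x : ℝ => -(Complex.I * ω * (x:ℂ))) (-(Complex.I * ω)) x := by
      have := (((hasDerivAt_id x).ofReal_comp).const_mul (Complex.I * ω)).neg
      refine this.congr_deriv ?_
      simp
    exact h.cexp
  have := ((d1.mul d2).mul d4).mul d5
  refine this.congr_deriv ?_
  have hz1 : rr x ^ (b-1) = rr x ^ (b-2) * rr x := by rw [← zpow_add_one₀ hr.ne']; ring_nf
  have hz2 : rr x ^ b = rr x ^ (b-2) * rr x ^ 2 := by
    rw [← zpow_natCast, ← zpow_add₀ hr.ne']; ring_nf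
  have hsq : (rr x : ℂ)^2 = 1 - (x:ℂ)^2 := by exact_mod_cast rr_sq hx
  simp only [qq, Pi.mul_apply, eval_mul, eval_sub, eval_X, eval_C, eval_one, eval_pow]
  rw [hz1, hz2]
  push_cast
  rw [← hsq]
  field_simp
  ring

lemma poly_bdd (P : Polynomial ℂ) : ∃ K : ℝ, 0 ≤ K ∧ ∀ x ∈ Set.Ioo (-1:ℝ) 1, ‖P.eval (x:ℂ)‖ ≤ K := by
  have hc : ContinuousOn (fun x : ℝ => P.eval (x:ℂ)) (Set.Icc (-1) 1) :=
    (P.continuous.comp Complex.continuous_ofReal).continuousOn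
  obtain ⟨K, hK⟩ := isCompact_Icc.exists_bound_of_continuousOn hc
  exact ⟨|K|, abs_nonneg K, fun x hx => (hK x (Set.Ioo_subset_Icc_self hx)).trans (le_abs_self K)⟩

lemma qq_norm {Ψ : ℕ → ℝ → ℂ} {p : ℕ} (hΨ : Fam p Ψ) (P : Polynomial ℂ) (j : ℕ) :
    ∃ C : ℝ, 0 ≤ C ∧ ∀ (b : ℤ) (A ω : ℝ), 0 < A → ∀ x ∈ Set.Ioo (-1:ℝ) 1,
      ‖qq Ψ A ω P b j x‖ ≤ C * (A ^ p)⁻¹ * rr x ^ (b + p) := by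
  obtain ⟨K, hK, h⟩ := poly_bdd P
  obtain ⟨D, hD, h'⟩ := hΨ.2 j
  refine ⟨K * D, by positivity, fun b A ω hA x hx => ?_⟩
  have hr := rr_pos hx
  have h1 := h x hx
  have h2 := h' (A / rr x) (by positivity)
  have h3 : ‖Ψ j (A / rr x)‖ ≤ D * (A^p)⁻¹ * rr x ^ p := by
    rw [div_pow, div_mul_eq_mul_div, div_le_iff₀ (by positivity)] at h2
    have : 0 < A^p := by positivity
    rw [mul_right_comm, ← div_eq_mul_inv, le_div_iff₀ this]
    linarith
  have h4 : ‖Complex.exp (-(Complex.I * ω * x))‖ = 1 := by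
    rw [Complex.norm_exp]; simp
  unfold qq
  rw [norm_mul, norm_mul, norm_mul, h4, mul_one, Complex.norm_real, Real.norm_of_nonneg (by positivity)]
  rw [zpow_add₀ hr.ne', zpow_natCast]
  calc _ ≤ K * rr x ^ b * (D * (A^p)⁻¹ * rr x ^ p) := by gcongr
    _ = _ := by ring

lemma rr_zpow_le {x : ℝ} (hx : x ∈ Set.Ioo (-1:ℝ) 1) {m n : ℤ} (h : m ≤ n) : rr x ^ n ≤ rr x ^ m :=
  zpow_le_zpow_right_of_le_one₀ (rr_pos hx) (rr_le_one x) h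

lemma qq_int {Ψ : ℕ → ℝ → ℂ} {p : ℕ} (hΨ : Fam p Ψ) {A : ℝ} (hA : 0 < A) (ω : ℝ) (P : Polynomial ℂ) (b : ℤ) (j : ℕ)
    (hb : -1 ≤ b + p) : IntervalIntegrable (qq Ψ A ω P b j) volume (-1) 1 := by
  obtain ⟨C, hC, h⟩ := qq_norm hΨ P j
  have hi := rr_inv_int
  rw [intervalIntegrable_iff_integrableOn_Ioo_of_le (by norm_num)] at *
  refine Integrable.mono' (hi.const_mul (C * (A ^ p)⁻¹)) ?_ ?_
  · refine ContinuousOn.aestronglyMeasurable (fun x hx => ?_) measurableSet_Ioo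
    exact (qq_deriv hΨ hA ω P b j hx).continuousAt.continuousWithinAt
  · filter_upwards [ae_restrict_mem measurableSet_Ioo] with x hx
    refine (h b A ω hA x hx).trans ?_
    have := rr_zpow_le hx hb
    rw [zpow_neg_one] at this
    gcongr

lemma rr_tendsto (a : ℝ) (ha : a^2 = 1) : Filter.Tendsto rr (nhds a) (nhds 0) := by
  have : Continuous rr := by unfold rr; fun_prop
  have h := this.tendsto a
  have e : rr a = 0 := by simp [rr, ha]
  rwa [e] at h

open Polynomial in
lemma qq_step {Ψ : ℕ → ℝ → ℂ} {p : ℕ} (hΨ : Fam p Ψ) {A : ℝ} (hA : 0 < A) (ω : ℝ) (P : Polynomial ℂ) (b : ℤ) (j : ℕ)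
    (hb : 1 ≤ b + p) : Complex.I * ω * ∫ x in (-1:ℝ)..1, qq Ψ A ω P b j x = 
      (∫ x in (-1:ℝ)..1, qq Ψ A ω (derivative P * (1 - X^2) - C (b:ℂ) * X * P) (b-2) j x) +
      ∫ x in (-1:ℝ)..1, qq Ψ A ω (X * P) (b-2) (j+1) x := by
  have i1 := qq_int hΨ hA ω (derivative P * (1 - X^2) - C (b:ℂ) * X * P) (b-2) j (by linarith)
  have i2 := qq_int hΨ hA ω (X * P) (b-2) (j+1) (by linarith)
  have i3 := qq_int hΨ hA ω P b j (by linarith)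
  obtain ⟨K, hK, h⟩ := qq_norm hΨ P j
  have hlim : ∀ a : ℝ, a^2 = 1 → ∀ s : Set ℝ, Set.Ioo (-1:ℝ) 1 ∈ nhdsWithin a s →
      Filter.Tendsto (qq Ψ A ω P b j) (nhdsWithin a s) (nhds 0) := by
    intro a ha s hs
    have ht := ((rr_tendsto a ha).mono_left (nhdsWithin_le_nhds (s := s))).const_mul (K * (A ^ p)⁻¹)
    rw [mul_zero] at ht
    refine squeeze_zero_norm' ?_ ht
    filter_upwards [hs] with x hx
    refine (h b A ω hA x hx).trans ?_
    have := rr_zpow_le hx hb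
    rw [zpow_one] at this
    gcongr
  have key := intervalIntegral.integral_eq_sub_of_hasDerivAt_of_tendsto (a := -1) (b := 1) (by norm_num)
    (fun x hx => qq_deriv hΨ hA ω P b j hx) ((i1.add i2).sub (i3.const_mul _))
    (hlim (-1) (by norm_num) _ (Ioo_mem_nhdsGT (by norm_num))) (hlim 1 (by norm_num) _ (Ioo_mem_nhdsLT (by norm_num)))
  rw [intervalIntegral.integral_sub (i1.add i2) (i3.const_mul _), intervalIntegral.integral_add i1 i2,
    intervalIntegral.integral_const_mul, sub_self] at key
  exact (sub_eq_zero.1 key).symm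

lemma qq_bound {Ψ : ℕ → ℝ → ℂ} {p : ℕ} (hΨ : Fam p Ψ) (m : ℕ) : ∀ (P : Polynomial ℂ) (j : ℕ),
    ∃ C : ℝ, 0 ≤ C ∧ ∀ A ω : ℝ, 0 < A → ω ≠ 0 →
      ‖∫ x in (-1:ℝ)..1, qq Ψ A ω P (-1 - p + 2 * m) j x‖ ≤ C * (|ω| ^ m)⁻¹ * (A ^ p)⁻¹ := by
  induction m with
  | zero =>
    intro P j
    obtain ⟨K, hK, h⟩ := qq_norm hΨ P j
    have hi := rr_inv_int
    refine ⟨K * ∫ x in (-1:ℝ)..1, (rr x)⁻¹, ?_, fun A ω hA hω => ?_⟩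
    · have : 0 ≤ ∫ x in (-1:ℝ)..1, (rr x)⁻¹ := 
        intervalIntegral.integral_nonneg (by norm_num) fun x _ => inv_nonneg.2 (Real.sqrt_nonneg _)
      positivity
    · have := intervalIntegral.norm_integral_le_of_norm_le (a := -1) (b := 1) (μ := volume) 
        (f := fun x => qq Ψ A ω P (-1 - p + 2 * (0:ℕ)) j x) (g := fun x => K * (A ^ p)⁻¹ * (rr x)⁻¹) (by norm_num) ?_ (hi.const_mul _)
      · rw [intervalIntegral.integral_const_mul] at this
        refine this.trans (le_of_eq ?_)
        simp; ring
      · have : ∀ᵐ x : ℝ, x ≠ 1 := by simp [ae_iff]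
        filter_upwards [this] with x hx1 hx
        have hx' : x ∈ Set.Ioo (-1:ℝ) 1 := ⟨hx.1, lt_of_le_of_ne hx.2 hx1⟩
        have := h (-1 - p + 2 * (0:ℕ)) A ω hA x hx'
        refine this.trans (le_of_eq ?_)
        congr 1
        rw [← zpow_neg_one]; congr 1; push_cast; ring
  | succ m ih =>
    intro P j
    obtain ⟨C1, hC1, h1⟩ := ih (Polynomial.derivative P * (1 - Polynomial.X^2) - Polynomial.C (((-1 - p + 2 * (m+1:ℕ) : ℤ)):ℂ) * Polynomial.X * P) j
    obtain ⟨C2, hC2, h2⟩ := ih (Polynomial.X * P) (j+1)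
    refine ⟨C1 + C2, by positivity, fun A ω hA hω => ?_⟩
    have key := qq_step hΨ hA ω P (-1 - p + 2 * (m+1:ℕ)) j (by push_cast; linarith [(Int.natCast_nonneg m)])
    have e : (-1 - (p:ℤ) + 2 * (m+1:ℕ)) - 2 = -1 - p + 2 * m := by push_cast; ring
    rw [e] at key
    have k1 := h1 A ω hA hω
    have k2 := h2 A ω hA hω
    have hω' : 0 < |ω| := abs_pos.2 hω
    have hn : |ω| * ‖∫ x in (-1:ℝ)..1, qq Ψ A ω P (-1 - p + 2 * (m+1:ℕ)) j x‖ ≤ (C1 + C2) * (|ω| ^ m)⁻¹ * (A ^ p)⁻¹ := by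
      have : |ω| = ‖Complex.I * (ω:ℂ)‖ := by simp
      rw [this, ← norm_mul, key, ← this]
      refine (norm_add_le _ _).trans ?_
      linarith
    rw [mul_comm, ← le_div_iff₀ hω'] at hn
    refine hn.trans (le_of_eq ?_)
    rw [pow_succ, mul_inv]; field_simp


lemma theta_poly (n : ℕ) : ∃ P Q : Polynomial ℂ, ∀ x r : ℂ, r^2 = 1 - x^2 →
    (x + Complex.I * r)^n = P.eval x + Complex.I * r * Q.eval x ∧
    (x - Complex.I * r)^n = P.eval x - Complex.I * r * Q.eval x := by
  induction n with
  | zero => exact ⟨1, 0, fun x r _ => by simp⟩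
  | succ n ih =>
    obtain ⟨P, Q, h⟩ := ih
    refine ⟨Polynomial.X * P - (1 - Polynomial.X^2) * Q, P + Polynomial.X * Q, fun x r hr => ?_⟩
    obtain ⟨h1, h2⟩ := h x r hr
    rw [pow_succ (x + Complex.I * r), pow_succ (x - Complex.I * r), h1, h2]
    simp only [Polynomial.eval_sub, Polynomial.eval_mul, Polynomial.eval_add, Polynomial.eval_X, Polynomial.eval_one, Polynomial.eval_pow]
    rw [← hr]
    constructor
    · linear_combination (r^2 * Q.eval x) * Complex.I_sq
    · linear_combination (r^2 * Q.eval x) * Complex.I_sq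

lemma theta_eq (k : ℕ) : ∃ P : Polynomial ℂ, ∀ x ∈ Set.Ioo (-1:ℝ) 1, 
    thetaInf k x = P.eval (x:ℂ) * ((rr x ^ (1:ℤ) : ℝ) : ℂ) := by
  obtain ⟨P, Q, h⟩ := theta_poly (k-1)
  refine ⟨Polynomial.C (-(1/(Real.pi:ℂ))) * Q, fun x hx => ?_⟩
  have hsq : (rr x : ℂ)^2 = 1 - (x:ℂ)^2 := by exact_mod_cast rr_sq hx
  obtain ⟨h1, h2⟩ := h x (rr x) hsq
  have hpi : (Real.pi:ℂ) ≠ 0 := by exact_mod_cast Real.pi_ne_zero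
  rw [thetaInf, if_pos (abs_lt.2 hx)]
  change _ * ((_ + _ * ((rr x : ℝ) : ℂ))^_ - (_ - _ * ((rr x : ℝ) : ℂ))^_) = _
  rw [h1, h2]
  simp only [Polynomial.eval_mul, Polynomial.eval_C, zpow_one]
  field_simp
  linear_combination (2 * (rr x : ℂ) * Q.eval (x:ℂ)) * Complex.I_sq

lemma inner_eq (k l f : ℕ) (hl : 0 < l) (hf : 0 < f) (ξ : ℤ) (X : ℝ) (G : ℝ → ℂ) {Ψ : ℕ → ℝ → ℂ}
    (hΨ : ∀ z : ℝ, 0 < z → Ψ 0 z = (Fcut z : ℂ) + z * Hfun z) {P : Polynomial ℂ} 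
    (hP : ∀ x ∈ Set.Ioo (-1:ℝ) 1, thetaInf k x = P.eval (x:ℂ) * ((rr x ^ (1:ℤ) : ℝ) : ℂ)) (y : ℝ) (hy : 0 < y) :
    (∫ x in (-1 : ℝ)..1,
    ((Real.sqrt y : ℝ) : ℂ) * G (y / X) * thetaInf k x *
      (((Fcut ((l * f ^ 2 : ℝ) / (2 * Real.sqrt y * Real.sqrt (1 - x ^ 2))) : ℝ) : ℂ) +
        (((l * f ^ 2 : ℝ) / (2 * Real.sqrt y * Real.sqrt (1 - x ^ 2)) : ℝ) : ℂ) *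
          Hfun ((l * f ^ 2 : ℝ) / (2 * Real.sqrt y * Real.sqrt (1 - x ^ 2)))) *
      e2 (-(2 * x * (ξ : ℝ) * Real.sqrt y + y * ((0:ℤ) : ℝ)) / (4 * (l : ℝ) * (f : ℝ) ^ 2))) =
    ((Real.sqrt y : ℝ) : ℂ) * G (y / X) * ∫ x in (-1:ℝ)..1, 
      qq Ψ ((l * f ^ 2 : ℝ) / (2 * Real.sqrt y)) (Real.pi * ξ * Real.sqrt y / (l * f^2 : ℝ)) P 1 0 x := by
  rw [← intervalIntegral.integral_const_mul]
  rw [intervalIntegral.integral_of_le (by norm_num), intervalIntegral.integral_of_le (by norm_num),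
    integral_Ioc_eq_integral_Ioo, integral_Ioc_eq_integral_Ioo]
  refine setIntegral_congr_fun measurableSet_Ioo fun x hx => ?_
  have hr := rr_pos hx
  have hsy : 0 < Real.sqrt y := Real.sqrt_pos.2 hy
  have hl' : (0:ℝ) < l := by exact_mod_cast hl
  have hf' : (0:ℝ) < f := by exact_mod_cast hf
  have hlc : (l:ℂ) ≠ 0 := by exact_mod_cast hl.ne'
  have hfc : (f:ℂ) ≠ 0 := by exact_mod_cast hf.ne'
  have hz : 0 < (l * f ^ 2 : ℝ) / (2 * Real.sqrt y) / rr x := by positivity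
  have e0 : (l * f ^ 2 : ℝ) / (2 * Real.sqrt y * Real.sqrt (1 - x ^ 2)) = (l * f ^ 2 : ℝ) / (2 * Real.sqrt y) / rr x := by
    rw [div_div]; rfl
  have e1 : e2 (-(2 * x * (ξ : ℝ) * Real.sqrt y + y * ((0:ℤ) : ℝ)) / (4 * (l : ℝ) * (f : ℝ) ^ 2)) =
      Complex.exp (-(Complex.I * ((Real.pi * ξ * Real.sqrt y / (l * f^2 : ℝ) : ℝ) : ℂ) * x)) := by
    unfold e2
    congr 1
    push_cast
    field_simp
    ring
  rw [e0, e1, ← hΨ _ hz, hP x hx, qq]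
  ring

/-- For `k ≥ 3` and every `N ∈ ℕ` there is a constant `C` (depending only on
`k` and `N`) such that for every smooth `G` supported in `[1/4, 5/4]`, every
`X ≥ 1`, all positive `l, f` and every nonzero `ξ ∈ ℤ`:
`|J_{l,f}(ξ, 0, X)| ≤ C·‖G‖₁·X^{(N+3)/2}/((lf²)^N·|ξ|^{N+2})`. -/
theorem Jlf_bound_nu_zero (k : ℕ) (hk : 3 ≤ k) (N : ℕ) :
    ∃ C : ℝ, ∀ G : ℝ → ℂ, ContDiff ℝ (⊤ : ℕ∞) G →
      Function.support G ⊆ Set.Icc (1/4 : ℝ) (5/4) →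
      ∀ X : ℝ, 1 ≤ X → ∀ l f : ℕ, 0 < l → 0 < f → ∀ ξ : ℤ, ξ ≠ 0 →
        ‖Jlf k l f ξ 0 X G‖ ≤
          C * (∫ t : ℝ, ‖G t‖) * X ^ (((N : ℝ) + 3) / 2) /
            ((l * f ^ 2 : ℝ) ^ N * |(ξ : ℝ)| ^ (N + 2)) := by

  obtain ⟨Ψ, hfam, hΨ⟩ := exists_fam (2*N+2)
  obtain ⟨P, hP⟩ := theta_eq k
  obtain ⟨C, hC, hbd⟩ := qq_bound hfam (N+2) P 0
  have hb1 : (-1 - ((2*N+2 : ℕ):ℤ) + 2 * ((N+2:ℕ):ℤ)) = 1 := by push_cast; ring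
  rw [hb1] at hbd
  refine ⟨C * 2^(2*N+2) / Real.pi^(N+2) * 2^(N+1), ?_⟩
  intro G hG hsupp X hX l f hl hf ξ hξ
  have hX0 : 0 < X := by linarith
  have hl' : (0:ℝ) < l := by exact_mod_cast hl
  have hf' : (0:ℝ) < f := by exact_mod_cast hf
  have hξ' : (ξ:ℝ) ≠ 0 := by exact_mod_cast hξ
  have hξa : 0 < |(ξ:ℝ)| := abs_pos.2 hξ'
  have hpi := Real.pi_pos
  set L : ℝ := l * f^2 with hL
  have hL0 : 0 < L := by positivity
  set B : ℝ := C * 2^(2*N+2) / Real.pi^(N+2) * 2^(N+1) * (Real.sqrt X)^(N+1) / (L^N * |(ξ:ℝ)|^(N+2)) with hB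
  have hB0 : 0 ≤ B := by positivity
  have hcs : HasCompactSupport G := by
    refine HasCompactSupport.of_support_subset_isCompact isCompact_Icc hsupp
  have hGi : Integrable (fun t => ‖G t‖) := (hG.continuous.integrable_of_hasCompactSupport hcs).norm
  have hGi' : Integrable (fun y : ℝ => ‖G (y / X)‖) := hGi.comp_div hX0.ne'
  have hmain : ‖Jlf k l f ξ 0 X G‖ ≤ ∫ y in Set.Ioi (0:ℝ), B * ‖G (y/X)‖ := by
    unfold Jlf
    refine norm_integral_le_of_norm_le (hGi'.const_mul B).integrableOn ?_
    filter_upwards [ae_restrict_mem measurableSet_Ioi] with y hy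
    have hy0 : 0 < y := hy
    rw [inner_eq k l f hl hf ξ X G hΨ hP y hy0]
    by_cases hg : G (y/X) = 0
    · simp [hg]
    have hyX := hsupp (show y/X ∈ Function.support G from hg)
    have hs : 0 < Real.sqrt y := Real.sqrt_pos.2 hy0
    have hyle : Real.sqrt y ≤ 2 * Real.sqrt X := by
      have h1 : y ≤ 2^2 * X := by
        have := hyX.2
        rw [div_le_iff₀ hX0] at this
        linarith
      calc Real.sqrt y ≤ Real.sqrt (2^2 * X) := Real.sqrt_le_sqrt h1
        _ = _ := by rw [Real.sqrt_mul (by norm_num), Real.sqrt_sq (by norm_num)]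
    have hq := hbd (L / (2 * Real.sqrt y)) (Real.pi * ξ * Real.sqrt y / L) (by positivity)
      (by simp [hξ, hpi.ne', hs.ne', hL0.ne'])
    rw [norm_mul, norm_mul, Complex.norm_real, Real.norm_of_nonneg hs.le]
    have habs : |Real.pi * ξ * Real.sqrt y / L| = Real.pi * |(ξ:ℝ)| * Real.sqrt y / L := by
      rw [abs_div, abs_mul, abs_mul, abs_of_pos hpi, abs_of_pos hs, abs_of_pos hL0]
    rw [habs] at hq
    calc _ ≤ Real.sqrt y * ‖G (y/X)‖ * (C * ((Real.pi * |(ξ:ℝ)| * Real.sqrt y / L) ^ (N+2))⁻¹ * ((L / (2 * Real.sqrt y)) ^ (2*N+2))⁻¹) := by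
          gcongr
      _ = C * 2^(2*N+2) / Real.pi^(N+2) * (Real.sqrt y)^(N+1) / (L^N * |(ξ:ℝ)|^(N+2)) * ‖G (y/X)‖ := by
          clear_value L
          have eA : Real.sqrt y ^ (2*N+2) = Real.sqrt y ^ N * Real.sqrt y ^ (N+2) := by ring
          have eB : L ^ (2*N+2) = L ^ N * L ^ (N+2) := by ring
          rw [div_pow, div_pow, inv_div, inv_div, mul_pow (Real.pi * |(ξ:ℝ)|), mul_pow Real.pi, mul_pow 2 (Real.sqrt y), eA, eB]
          field_simp
          ring
      _ ≤ C * 2^(2*N+2) / Real.pi^(N+2) * (2 * Real.sqrt X)^(N+1) / (L^N * |(ξ:ℝ)|^(N+2)) * ‖G (y/X)‖ := by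
          gcongr
      _ = B * ‖G (y/X)‖ := by rw [hB, mul_pow]; ring
  have hscale : ∫ y in Set.Ioi (0:ℝ), B * ‖G (y/X)‖ ≤ B * (X * ∫ t, ‖G t‖) := by
    rw [integral_const_mul]
    gcongr
    calc _ ≤ ∫ y : ℝ, ‖G (y/X)‖ := 
          setIntegral_le_integral hGi' (Filter.Eventually.of_forall fun y => norm_nonneg _)
      _ = _ := by
        rw [Measure.integral_comp_div (fun t => ‖G t‖) X, abs_of_pos hX0, smul_eq_mul]
  refine (hmain.trans hscale).trans (le_of_eq ?_)
  have hXp : X ^ (((N : ℝ) + 3) / 2) = (Real.sqrt X)^(N+1) * X := by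
    rw [Real.sqrt_eq_rpow, ← Real.rpow_natCast, ← Real.rpow_mul hX0.le, ← Real.rpow_add_one hX0.ne']
    congr 1; push_cast; ring
  rw [hXp, hB]
  ring
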